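/- For every rate demand vector r ∈ ℝ^N with r > 0 componentwise, the load mapping Γ_r has at most one fixed point in the nonnegative orthant ℝ_+^M: if ρ ≥ 0, ρ' ≥ 0, Γ_r(ρ) = ρ and Γ_r(ρ') = ρ', then ρ = ρ'. -/

import Mathlib

open Finset

/-- SINR of the link from base station `i` to test point `j`, given load vector `ρ`. -/
noncomputable def gamma (M N : ℕ) (p : Fin M → ℝ) (G : Fin M → Fin N → ℝ) (s2 : ℝ)
    (ρ : Fin M → ℝ) (i : Fin M) (j : Fin N) : ℝ :=
  p i * G i j / ((∑ k ∈ Finset.univ.erase i, p k * G k j * ρ k) + s2)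

/-- The load mapping `q(ρ, r)`; `serv j` is the (unique) base station serving test point `j`,
so that `N(i) = {j | serv j = i}`. -/
noncomputable def loadMap (M N : ℕ) (p : Fin M → ℝ) (G : Fin M → Fin N → ℝ) (s2 c : ℝ)
    (serv : Fin N → Fin M) (ρ : Fin M → ℝ) (r : Fin N → ℝ) : Fin M → ℝ :=
  fun i => (1 / c) * ∑ j ∈ Finset.univ.filter (fun j => serv j = i),
    r j / Real.log (1 + gamma M N p G s2 ρ i j)

/-- A rate vector `r > 0` is feasible if the load mapping `Γ_r` has a fixed point `ρ*`
with `0 ≤ ρ* ≤ 1` componentwise. -/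
def Feasible (M N : ℕ) (p : Fin M → ℝ) (G : Fin M → Fin N → ℝ) (s2 c : ℝ)
    (serv : Fin N → Fin M) (r : Fin N → ℝ) : Prop :=
  ∃ ρ : Fin M → ℝ, (∀ i, 0 ≤ ρ i) ∧ (∀ i, ρ i ≤ 1) ∧ loadMap M N p G s2 c serv ρ r = ρ

/-- The feasible rate region `X`. -/
def FeasRegion (M N : ℕ) (p : Fin M → ℝ) (G : Fin M → Fin N → ℝ) (s2 c : ℝ)
    (serv : Fin N → Fin M) (rmin : Fin N → ℝ) : Set (Fin N → ℝ) :=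
  {r | (∀ j, 0 < r j) ∧ (∀ j, rmin j ≤ r j) ∧ Feasible M N p G s2 c serv r}

theorem log_one_add_lt_mul_log_one_add {a x y : ℝ} (ha : 1 < a) (hx : 0 < x) (hy : 0 < y)
    (h : x < a * y) : Real.log (1 + x) < a * Real.log (1 + y) := by
  rw [← Real.log_rpow (by linarith)]
  apply Real.log_lt_log (by linarith)
  have := one_add_mul_self_le_rpow_one_add (by linarith : -1 ≤ y) ha.le
  linarith

section

variable {M N : ℕ} {p : Fin M → ℝ} {G : Fin M → Fin N → ℝ} {s2 c : ℝ} {serv : Fin N → Fin M}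
  {r : Fin N → ℝ} {ρ ρ' : Fin M → ℝ}

theorem interference_nonneg (hp : ∀ i, 0 < p i) (hG : ∀ k j, 0 ≤ G k j) (hρ : ∀ i, 0 ≤ ρ i)
    (i : Fin M) (j : Fin N) : 0 ≤ ∑ k ∈ Finset.univ.erase i, p k * G k j * ρ k :=
  Finset.sum_nonneg fun k _ => mul_nonneg (mul_nonneg (hp k).le (hG k j)) (hρ k)

theorem gamma_pos (hp : ∀ i, 0 < p i) (hG : ∀ k j, 0 ≤ G k j) (hs2 : 0 < s2)
    (hρ : ∀ i, 0 ≤ ρ i) {i : Fin M} {j : Fin N} (hij : 0 < G i j) :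
    0 < gamma M N p G s2 ρ i j :=
  div_pos (mul_pos (hp i) hij) (add_pos_of_nonneg_of_pos (interference_nonneg hp hG hρ i j) hs2)

theorem gamma_lt_mul_gamma (hp : ∀ i, 0 < p i) (hG : ∀ k j, 0 ≤ G k j) (hs2 : 0 < s2)
    (hρ : ∀ i, 0 ≤ ρ i) (hρ' : ∀ i, 0 ≤ ρ' i) {a : ℝ} (ha : 1 < a) (h : ∀ k, ρ' k ≤ a * ρ k)
    {i : Fin M} {j : Fin N} (hij : 0 < G i j) :
    gamma M N p G s2 ρ i j < a * gamma M N p G s2 ρ' i j := by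
  have hI := interference_nonneg hp hG hρ i j
  have hI' := interference_nonneg hp hG hρ' i j
  have hle : ∑ k ∈ Finset.univ.erase i, p k * G k j * ρ' k
      ≤ a * ∑ k ∈ Finset.univ.erase i, p k * G k j * ρ k := by
    rw [Finset.mul_sum]
    refine Finset.sum_le_sum fun k _ => ?_
    have := mul_le_mul_of_nonneg_left (h k) (mul_nonneg (hp k).le (hG k j))
    linarith
  have hP := mul_pos (hp i) hij
  unfold gamma
  rw [← mul_div_assoc, div_lt_div_iff₀ (by linarith) (by linarith), mul_comm a, mul_assoc _ a]
  apply mul_lt_mul_of_pos_left _ hP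
  nlinarith

theorem loadMap_pos (hp : ∀ i, 0 < p i) (hG : ∀ k j, 0 ≤ G k j) (hs2 : 0 < s2) (hc : 0 < c)
    (hserv : ∀ j, 0 < G (serv j) j) (hr : ∀ j, 0 < r j) (hρ : ∀ i, 0 ≤ ρ i) {i : Fin M}
    (hi : (Finset.univ.filter fun j => serv j = i).Nonempty) :
    0 < loadMap M N p G s2 c serv ρ r i := by
  refine mul_pos (by positivity) (Finset.sum_pos (fun j hj => ?_) hi)
  obtain rfl := (Finset.mem_filter.1 hj).2
  have := gamma_pos hp hG hs2 hρ (hserv j)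
  exact div_pos (hr j) (Real.log_pos (by linarith))

theorem loadMap_lt_mul_loadMap (hp : ∀ i, 0 < p i) (hG : ∀ k j, 0 ≤ G k j) (hs2 : 0 < s2)
    (hc : 0 < c) (hserv : ∀ j, 0 < G (serv j) j) (hr : ∀ j, 0 < r j) (hρ : ∀ i, 0 ≤ ρ i)
    (hρ' : ∀ i, 0 ≤ ρ' i) {a : ℝ} (ha : 1 < a) (h : ∀ k, ρ' k ≤ a * ρ k) {i : Fin M}
    (hi : (Finset.univ.filter fun j => serv j = i).Nonempty) :
    loadMap M N p G s2 c serv ρ' r i < a * loadMap M N p G s2 c serv ρ r i := by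
  unfold loadMap
  rw [mul_left_comm, Finset.mul_sum _ _ a]
  refine mul_lt_mul_of_pos_left (Finset.sum_lt_sum_of_nonempty hi fun j hj => ?_)
    (one_div_pos.2 hc)
  obtain rfl := (Finset.mem_filter.1 hj).2
  have hg := gamma_pos hp hG hs2 hρ (hserv j)
  have hg' := gamma_pos hp hG hs2 hρ' (hserv j)
  have hlog := log_one_add_lt_mul_log_one_add ha hg hg'
    (gamma_lt_mul_gamma hp hG hs2 hρ hρ' ha h (hserv j))
  rw [← mul_div_assoc, div_lt_div_iff₀ (Real.log_pos (by linarith)) (Real.log_pos (by linarith)),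
    mul_comm a, mul_assoc]
  exact mul_lt_mul_of_pos_left hlog (hr j)

theorem loadMap_eq_zero {i : Fin M}
    (hi : ¬ (Finset.univ.filter fun j => serv j = i).Nonempty) :
    loadMap M N p G s2 c serv ρ r i = 0 := by
  simp [loadMap, Finset.not_nonempty_iff_eq_empty.1 hi]

theorem loadMap_fixedPoint_le (hp : ∀ i, 0 < p i) (hG : ∀ k j, 0 ≤ G k j) (hs2 : 0 < s2)
    (hc : 0 < c) (hserv : ∀ j, 0 < G (serv j) j) (hr : ∀ j, 0 < r j) (hρ : ∀ i, 0 ≤ ρ i)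
    (hρ' : ∀ i, 0 ≤ ρ' i) (hfix : loadMap M N p G s2 c serv ρ r = ρ)
    (hfix' : loadMap M N p G s2 c serv ρ' r = ρ') : ρ' ≤ ρ := by
  by_contra hcon
  obtain ⟨k, hk⟩ : ∃ k, ρ k < ρ' k := by simpa [Pi.le_def] using hcon
  have : Nonempty (Fin M) := ⟨k⟩
  have hpos : ∀ i, 0 < ρ' i → 0 < ρ i := fun i h => by
    by_cases hi : (Finset.univ.filter fun j => serv j = i).Nonempty
    · rw [← hfix]
      exact loadMap_pos hp hG hs2 hc hserv hr hρ hi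
    · rw [← hfix', loadMap_eq_zero hi] at h
      exact absurd h (lt_irrefl 0)
  obtain ⟨i, hi⟩ := Finite.exists_max fun i => ρ' i / ρ i
  have ha : 1 < ρ' i / ρ i :=
    ((one_lt_div (hpos k ((hρ k).trans_lt hk))).2 hk).trans_le (hi k)
  have hρi : ρ i ≠ 0 := fun h => by
    rw [h, div_zero] at ha
    linarith
  have hle : ∀ l, ρ' l ≤ ρ' i / ρ i * ρ l := fun l => by
    rcases (hρ' l).eq_or_lt with h | h
    · rw [← h]
      exact mul_nonneg (by linarith) (hρ l)
    · exact (div_le_iff₀ (hpos l h)).1 (hi l)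
  have hne : (Finset.univ.filter fun j => serv j = i).Nonempty := by
    by_contra h
    exact hρi (by rw [← hfix, loadMap_eq_zero h])
  have hlt := loadMap_lt_mul_loadMap hp hG hs2 hc hserv hr hρ hρ' ha hle hne
  rw [hfix, hfix', div_mul_cancel₀ _ hρi] at hlt
  exact lt_irrefl _ hlt

end

/-- For every `r > 0`, the load mapping `Γ_r` has at most one fixed
point in the nonnegative orthant. -/
theorem loadMap_fixedPoint_unique
    {M N : ℕ} (hM : 0 < M) (hN : 0 < N)
    (p : Fin M → ℝ) (hp : ∀ i, 0 < p i)
    (G : Fin M → Fin N → ℝ) (hG : ∀ k j, 0 ≤ G k j)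
    (s2 : ℝ) (hs2 : 0 < s2) (c : ℝ) (hc : 0 < c)
    (serv : Fin N → Fin M) (hserv : ∀ j, 0 < G (serv j) j)
    (r : Fin N → ℝ) (hr : ∀ j, 0 < r j)
    (ρ ρ' : Fin M → ℝ) (hρ0 : ∀ i, 0 ≤ ρ i) (hρ'0 : ∀ i, 0 ≤ ρ' i)
    (hfix : loadMap M N p G s2 c serv ρ r = ρ)
    (hfix' : loadMap M N p G s2 c serv ρ' r = ρ') :
    ρ = ρ' := by
  exact le_antisymm (loadMap_fixedPoint_le hp hG hs2 hc hserv hr hρ'0 hρ0 hfix' hfix)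
    (loadMap_fixedPoint_le hp hG hs2 hc hserv hr hρ0 hρ'0 hfix hfix')
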